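/- arXiv:2506.15259 — 3 statements merged into one kernel-verified Lean document; each statement's English description precedes it below -/
import Mathlib

section
/- (Exactness of the dynamical rangefinder ODE.) Let F : ℝ × ℝ^{m×n} → ℝ^{m×n}, let N : [t0, t0+h] → ℝ^{m×n} be differentiable with Ṅ(t) = F(t, N(t)) for all t ∈ [t0, t0+h], and let Ω ∈ ℝ^{n×k} have full column rank. Assume the corange condition Range(N(t)ᵀ) ⊆ Range(Ω) for all t ∈ [t0, t0+h]. Then B(t) := N(t)Ω is differentiable and solves the autonomous reduced m×k differential equation Ḃ(t) = F(t, B(t)(ΩᵀΩ)^{−1}Ωᵀ) Ω with B(t0) = N(t0)Ω. -/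
open scoped Matrix

attribute [local instance] Matrix.frobeniusNormedAddCommGroup Matrix.frobeniusNormedSpace

/-- A matrix of full column rank has an invertible Gram matrix. -/
theorem Matrix.isUnit_det_transpose_mul_self_of_rank {n k : ℕ}
    (Ω : Matrix (Fin n) (Fin k) ℝ) (hΩ : Ω.rank = k) : IsUnit (Ωᵀ * Ω).det := by
  rw [← Matrix.isUnit_iff_isUnit_det, ← Matrix.linearIndependent_cols_iff_isUnit,
    linearIndependent_iff_card_eq_finrank_span, Set.finrank, ← Matrix.rank_eq_finrank_span_cols,
    Matrix.rank_transpose_mul_self, hΩ, Fintype.card_fin]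

/-- A matrix whose row space lies in the column space of `Ω` is fixed by right multiplication
with the orthogonal projection onto that column space. -/
theorem Matrix.mul_gram_projection_eq_self {m n k : ℕ}
    (A : Matrix (Fin m) (Fin n) ℝ) (Ω : Matrix (Fin n) (Fin k) ℝ) (hΩ : Ω.rank = k)
    (hA : LinearMap.range Aᵀ.mulVecLin ≤ LinearMap.range Ω.mulVecLin) :
    A * Ω * (Ωᵀ * Ω)⁻¹ * Ωᵀ = A := by
  have hcol : ∀ i, ∃ c, Ω *ᵥ c = A.row i := fun i => by
    obtain ⟨c, hc⟩ := hA (LinearMap.mem_range_self Aᵀ.mulVecLin (Pi.single i 1))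
    refine ⟨c, ?_⟩
    simpa using hc
  choose C hC using hcol
  have hfac : A = Matrix.of C * Ωᵀ := by
    ext i j
    rw [← Matrix.row_apply A, ← hC i]
    simp [Matrix.mul_apply, Matrix.mulVec, dotProduct, mul_comm]
  rw [hfac, Matrix.mul_assoc _ Ωᵀ Ω, Matrix.mul_nonsing_inv_cancel_right _ _
    (Matrix.isUnit_det_transpose_mul_self_of_rank Ω hΩ)]

/-- Exactness of the dynamical rangefinder ODE: if `Ṅ(t) = F(t, N(t))` on `[t0, t0+h]`,
`Ω` has full column rank, and `Range(N(t)ᵀ) ⊆ Range(Ω)` for all `t`, then `B(t) = N(t)Ω`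
solves the reduced equation `Ḃ(t) = F(t, B(t)(ΩᵀΩ)⁻¹Ωᵀ) Ω` with `B(t0) = N(t0)Ω`. -/
theorem dynamical_rangefinder_exact {m n k : ℕ}
    (F : ℝ → Matrix (Fin m) (Fin n) ℝ → Matrix (Fin m) (Fin n) ℝ)
    (t0 h : ℝ) (N : ℝ → Matrix (Fin m) (Fin n) ℝ)
    (hN : ∀ t ∈ Set.Icc t0 (t0 + h), HasDerivAt N (F t (N t)) t)
    (Ω : Matrix (Fin n) (Fin k) ℝ) (hΩ : Ω.rank = k)
    (hcorange : ∀ t ∈ Set.Icc t0 (t0 + h),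
      LinearMap.range (N t)ᵀ.mulVecLin ≤ LinearMap.range Ω.mulVecLin) :
    ∀ t ∈ Set.Icc t0 (t0 + h),
      HasDerivAt (fun s : ℝ => N s * Ω)
        (F t (N t * Ω * (Ωᵀ * Ω)⁻¹ * Ωᵀ) * Ω) t := by
  intro t ht
  rw [Matrix.mul_gram_projection_eq_self _ _ hΩ (hcorange t ht)]
  exact ((LinearMap.toContinuousLinearMap
    (mulRightLinearMap (Fin m) ℝ Ω)).hasFDerivAt.comp_hasDerivAt t (hN t ht))
end

section
/- (Exactness of the DRSVD reduced ODE, Lemma 3.1 setting.) Let F : ℝ × ℝ^{m×n} → ℝ^{m×n}, let N : [t0, t0+h] → ℝ^{m×n} be differentiable with Ṅ(t) = F(t, N(t)) for all t ∈ [t0, t0+h], and let Q ∈ ℝ^{m×s} have orthonormal columns. Assume Range(N(t)) ⊆ Range(Q) for all t ∈ [t0, t0+h]. Then C(t) := N(t)ᵀQ is differentiable and solves the reduced n×s differential equation Ċ(t) = F(t, Q C(t)ᵀ)ᵀ Q with C(t0) = N(t0)ᵀQ, and moreover N(t) = Q C(t)ᵀ for all t ∈ [t0, t0+h]. -/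
open scoped Matrix

attribute [local instance] Matrix.frobeniusNormedAddCommGroup Matrix.frobeniusNormedSpace

/-- If the columns of `Q` are orthonormal, then `Q * Qᵀ` fixes every matrix whose column space
is contained in that of `Q`. -/
theorem Matrix.mul_transpose_mul_eq_of_range_le {l m n R : Type*} [Fintype l] [Fintype m]
    [Fintype n] [DecidableEq n] [DecidableEq l] [CommRing R] {Q : Matrix m l R}
    (hQ : Qᵀ * Q = 1) {A : Matrix m n R}
    (hA : LinearMap.range A.mulVecLin ≤ LinearMap.range Q.mulVecLin) :
    Q * (Qᵀ * A) = A := by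
  refine Matrix.ext_of_mulVec_single fun j => ?_
  obtain ⟨w, hw⟩ := hA ⟨Pi.single j 1, rfl⟩
  simp only [Matrix.mulVecLin_apply] at hw
  rw [← Matrix.mulVec_mulVec, ← Matrix.mulVec_mulVec, ← hw, Matrix.mulVec_mulVec w, hQ,
    Matrix.one_mulVec]

/-- Transposing and then multiplying on the right by a constant matrix commutes with
differentiation. -/
theorem HasDerivAt.matrix_transpose_mul_const {l m n : Type*} [Fintype l] [Fintype m] [Fintype n]
    {A : ℝ → Matrix m n ℝ} {A' : Matrix m n ℝ} {t : ℝ} (hA : HasDerivAt A A' t)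
    (B : Matrix m l ℝ) : HasDerivAt (fun u => (A u)ᵀ * B) (A'ᵀ * B) t :=
  let L : Matrix m n ℝ →ₗ[ℝ] Matrix n l ℝ :=
    { toFun := fun M => Mᵀ * B
      map_add' := fun M M' => by rw [Matrix.transpose_add, Matrix.add_mul]
      map_smul' := fun c M => by rw [Matrix.transpose_smul, Matrix.smul_mul, RingHom.id_apply] }
  L.toContinuousLinearMap.hasFDerivAt.comp_hasDerivAt t hA

/-- Exactness of the DRSVD reduced ODE: if `Ṅ(t) = F(t, N(t))` on `[t0, t0+h]`, `Q` has
orthonormal columns, and `Range(N(t)) ⊆ Range(Q)` for all `t`, then `C(t) = N(t)ᵀQ` solves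
the reduced equation `Ċ(t) = F(t, Q C(t)ᵀ)ᵀ Q` with `C(t0) = N(t0)ᵀQ`, and moreover
`N(t) = Q C(t)ᵀ` for all `t ∈ [t0, t0+h]`. -/
theorem drsvd_reduced_ode_exact {m n s : ℕ}
    (F : ℝ → Matrix (Fin m) (Fin n) ℝ → Matrix (Fin m) (Fin n) ℝ)
    (t0 h : ℝ) (N : ℝ → Matrix (Fin m) (Fin n) ℝ)
    (hN : ∀ t ∈ Set.Icc t0 (t0 + h), HasDerivAt N (F t (N t)) t)
    (Q : Matrix (Fin m) (Fin s) ℝ) (hQ : Qᵀ * Q = 1)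
    (hrange : ∀ t ∈ Set.Icc t0 (t0 + h),
      LinearMap.range (N t).mulVecLin ≤ LinearMap.range Q.mulVecLin) :
    ∀ t ∈ Set.Icc t0 (t0 + h),
      HasDerivAt (fun u : ℝ => (N u)ᵀ * Q)
        ((F t (Q * ((N t)ᵀ * Q)ᵀ))ᵀ * Q) t ∧
      N t = Q * ((N t)ᵀ * Q)ᵀ := by
  intro t ht
  have hproj : N t = Q * ((N t)ᵀ * Q)ᵀ := by
    rw [Matrix.transpose_mul, Matrix.transpose_transpose,
      Matrix.mul_transpose_mul_eq_of_range_le hQ (hrange t ht)]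
  refine ⟨?_, hproj⟩
  rw [← hproj]
  exact (hN t ht).matrix_transpose_mul_const Q
end

section
/- (Exact reconstruction in the generalized Nyström method.) Let A ∈ ℝ^{m×n}, let Q1 ∈ ℝ^{m×s1} and Q2 ∈ ℝ^{n×s2} have orthonormal columns, and assume Range(A) ⊆ Range(Q1) and Range(Aᵀ) ⊆ Range(Q2). Then A = (A Q2) (Q1ᵀ A Q2)^† (Q1ᵀ A), where (·)^† denotes the Moore–Penrose pseudoinverse. -/
open scoped Matrix
open Classical

/-- The Moore–Penrose pseudoinverse of a real matrix, characterized (uniquely) by the four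
Penrose conditions. -/
noncomputable def moorePenrose {m n : ℕ} (M : Matrix (Fin m) (Fin n) ℝ) :
    Matrix (Fin n) (Fin m) ℝ :=
  if h : ∃ X : Matrix (Fin n) (Fin m) ℝ,
      M * X * M = M ∧ X * M * X = X ∧ (M * X)ᵀ = M * X ∧ (X * M)ᵀ = X * M
  then h.choose else 0

/-- Every linear map between vector spaces has an inner generalized inverse. -/
theorem LinearMap.exists_comp_comp_self_eq {K V W : Type*} [Field K] [AddCommGroup V]
    [Module K V] [AddCommGroup W] [Module K W] (f : V →ₗ[K] W) :
    ∃ g : W →ₗ[K] V, f ∘ₗ g ∘ₗ f = f := by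
  obtain ⟨r, hr⟩ := f.rangeRestrict.exists_rightInverse_of_surjective f.range_rangeRestrict
  obtain ⟨g, hg⟩ := LinearMap.exists_extend r
  refine ⟨g, LinearMap.ext fun x => ?_⟩
  have h1 : g (f x) = r (f.rangeRestrict x) := LinearMap.congr_fun hg (f.rangeRestrict x)
  have h2 : f.rangeRestrict (r (f.rangeRestrict x)) = f.rangeRestrict x :=
    LinearMap.congr_fun hr (f.rangeRestrict x)
  simpa [h1] using congrArg Subtype.val h2

theorem Matrix.exists_mul_mul_self_eq {K ι κ : Type*} [Field K] [Fintype ι] [Fintype κ]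
    (M : Matrix ι κ K) : ∃ G : Matrix κ ι K, M * G * M = M := by
  obtain ⟨g, hg⟩ := (Matrix.toLin' M).exists_comp_comp_self_eq
  refine ⟨LinearMap.toMatrix' g, Matrix.toLin'.injective ?_⟩
  rw [Matrix.toLin'_mul, Matrix.toLin'_mul, Matrix.toLin'_toMatrix', LinearMap.comp_assoc, hg]

/-- A real matrix has an inner inverse `Y` for which `M * Y` is symmetric. -/
theorem Matrix.exists_mul_mul_self_eq_and_transpose_eq {ι κ : Type*} [Fintype ι] [Fintype κ]
    (M : Matrix ι κ ℝ) : ∃ Y : Matrix κ ι ℝ, M * Y * M = M ∧ (M * Y)ᵀ = M * Y := by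
  obtain ⟨G, hG⟩ := (Mᵀ * M).exists_mul_mul_self_eq
  have h1 : M * (G * Mᵀ * M - 1) = 0 := by
    rw [← Matrix.conjTranspose_mul_self_mul_eq_zero, Matrix.conjTranspose_eq_transpose_of_trivial,
      mul_sub, mul_one, sub_eq_zero]
    simpa only [Matrix.mul_assoc] using hG
  have h2 : M * G * Mᵀ * M = M := by
    rw [Matrix.mul_sub, Matrix.mul_one, sub_eq_zero] at h1
    simpa only [Matrix.mul_assoc] using h1
  have h3 : Mᵀ * M * Gᵀ * Mᵀ = Mᵀ := by
    simpa [Matrix.transpose_mul, Matrix.mul_assoc] using congrArg Matrix.transpose h2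
  refine ⟨G * Mᵀ, by simpa only [Matrix.mul_assoc] using h2, ?_⟩
  calc (M * (G * Mᵀ))ᵀ = M * Gᵀ * Mᵀ := by simp [Matrix.transpose_mul]
    _ = M * G * Mᵀ * M * Gᵀ * Mᵀ := by rw [h2]
    _ = M * G * (Mᵀ * M * Gᵀ * Mᵀ) := by simp only [Matrix.mul_assoc]
    _ = M * (G * Mᵀ) := by rw [h3, Matrix.mul_assoc]

/-- Existence of the Moore–Penrose pseudoinverse of a real matrix. -/
theorem Matrix.exists_penrose {ι κ : Type*} [Fintype ι] [Fintype κ] (M : Matrix ι κ ℝ) :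
    ∃ X : Matrix κ ι ℝ,
      M * X * M = M ∧ X * M * X = X ∧ (M * X)ᵀ = M * X ∧ (X * M)ᵀ = X * M := by
  obtain ⟨Y, hY, hYs⟩ := M.exists_mul_mul_self_eq_and_transpose_eq
  obtain ⟨W, hW, hWs⟩ := Mᵀ.exists_mul_mul_self_eq_and_transpose_eq
  have hZ : M * Wᵀ * M = M := by
    simpa [Matrix.transpose_mul, Matrix.mul_assoc] using congrArg Matrix.transpose hW
  have hZs : (Wᵀ * M)ᵀ = Wᵀ * M := by
    simpa [Matrix.transpose_mul] using hWs.symm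
  have hMX : M * (Wᵀ * M * Y) = M * Y := by
    rw [← Matrix.mul_assoc, ← Matrix.mul_assoc, hZ]
  have hXM : Wᵀ * M * Y * M = Wᵀ * M := by
    rw [Matrix.mul_assoc, Matrix.mul_assoc, ← Matrix.mul_assoc M, hY]
  refine ⟨Wᵀ * M * Y, by rw [hMX, hY], ?_, by rw [hMX, hYs], by rw [hXM, hZs]⟩
  rw [hXM, Matrix.mul_assoc, hMX, ← Matrix.mul_assoc]

theorem mul_moorePenrose_mul_self {m n : ℕ} (M : Matrix (Fin m) (Fin n) ℝ) :
    M * moorePenrose M * M = M := by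
  rw [moorePenrose, dif_pos M.exists_penrose]
  exact M.exists_penrose.choose_spec.1

/-- If `Q` has orthonormal columns, `Q * Qᵀ` fixes every matrix whose range lies in that of `Q`. -/
theorem Matrix.mul_transpose_mul_of_range_le {R ι κ σ : Type*} [CommRing R] [Fintype ι]
    [Fintype κ] [Fintype σ] [DecidableEq σ] {A : Matrix ι κ R} {Q : Matrix ι σ R}
    (hQ : Qᵀ * Q = 1) (h : LinearMap.range A.mulVecLin ≤ LinearMap.range Q.mulVecLin) :
    Q * (Qᵀ * A) = A := by
  refine Matrix.ext_of_mulVec_single fun j => ?_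
  obtain ⟨y, hy⟩ := h ⟨Pi.single j 1, rfl⟩
  simp only [Matrix.mulVecLin_apply] at hy
  rw [← Matrix.mulVec_mulVec, ← Matrix.mulVec_mulVec, ← hy, Matrix.mulVec_mulVec y, hQ,
    Matrix.one_mulVec]

/-- Exact reconstruction in the generalized Nyström method: if `Q1, Q2` have orthonormal
columns with `Range(A) ⊆ Range(Q1)` and `Range(Aᵀ) ⊆ Range(Q2)`, then
`A = (A Q2) (Q1ᵀ A Q2)^† (Q1ᵀ A)`. -/
theorem generalized_nystrom_exact {m n s1 s2 : ℕ} (A : Matrix (Fin m) (Fin n) ℝ)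
    (Q1 : Matrix (Fin m) (Fin s1) ℝ) (Q2 : Matrix (Fin n) (Fin s2) ℝ)
    (hQ1 : Q1ᵀ * Q1 = 1) (hQ2 : Q2ᵀ * Q2 = 1)
    (hr : LinearMap.range A.mulVecLin ≤ LinearMap.range Q1.mulVecLin)
    (hc : LinearMap.range Aᵀ.mulVecLin ≤ LinearMap.range Q2.mulVecLin) :
    A = (A * Q2) * moorePenrose (Q1ᵀ * A * Q2) * (Q1ᵀ * A) := by
  have h1 : Q1 * (Q1ᵀ * A) = A := Matrix.mul_transpose_mul_of_range_le hQ1 hr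
  have h2 : A * Q2 * Q2ᵀ = A := by
    simpa [Matrix.transpose_mul, Matrix.mul_assoc] using
      congrArg Matrix.transpose (Matrix.mul_transpose_mul_of_range_le hQ2 hc)
  have hM := mul_moorePenrose_mul_self (Q1ᵀ * A * Q2)
  set X := moorePenrose (Q1ᵀ * A * Q2)
  calc A = Q1 * (Q1ᵀ * (A * Q2 * Q2ᵀ)) := by rw [h2, h1]
    _ = Q1 * (Q1ᵀ * A * Q2) * Q2ᵀ := by simp only [Matrix.mul_assoc]
    _ = Q1 * (Q1ᵀ * A * Q2 * X * (Q1ᵀ * A * Q2)) * Q2ᵀ := by rw [hM]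
    _ = Q1 * (Q1ᵀ * A) * Q2 * X * (Q1ᵀ * (A * Q2 * Q2ᵀ)) := by simp only [Matrix.mul_assoc]
    _ = A * Q2 * X * (Q1ᵀ * A) := by rw [h1, h2]
end
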